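/- Let q(x,y,z) = x² + y² + 6Pz² with P a prime, P ∤ 6, and let n be a positive integer with (n, 6P) = 1. Then the local density r_p(q,n) := lim_{ν→∞} p^{−2ν} · #{x ∈ (ℤ/p^ν ℤ)³ : q(x) ≡ n (mod p^ν)} satisfies r_2(q,n) ≥ 1/2, r_3(q,n) ≥ 2/3, and r_P(q,n) ≥ 1 − 1/P. -/

import Mathlib

open Filter

/-- Number of solutions of `x² + y² + 6Pz² ≡ n` modulo `p^ν`. -/
noncomputable def localCount (P n p ν : ℕ) : ℕ :=
  Nat.card {v : ZMod (p ^ ν) × ZMod (p ^ ν) × ZMod (p ^ ν) //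
    v.1 ^ 2 + v.2.1 ^ 2 + ((6 * P : ℕ) : ZMod (p ^ ν)) * v.2.2 ^ 2 = ((n : ℕ) : ZMod (p ^ ν))}

open Classical in
theorem group_lift {G H : Type*} [CommGroup G] [CommGroup H] [Fintype G] [Fintype H]
    (φ : G →* H) (hs : Function.Surjective φ) (hk : ∀ g, φ g = 1 → ∃ s, s ^ 2 = g) (u : G) :
    (Finset.univ.filter (fun x : G => x ^ 2 = u)).card =
      (Finset.univ.filter (fun y : H => y ^ 2 = φ u)).card := by
  have h1 : (Finset.univ.filter (fun x : G => φ x ^ 2 = φ u)).card =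
      (Finset.univ.filter (fun y : H => y ^ 2 = φ u)).card *
        (Finset.univ.filter (fun x : G => φ x = 1)).card := by
    rw [Finset.card_eq_sum_card_fiberwise (f := φ)
      (t := Finset.univ.filter (fun y : H => y ^ 2 = φ u)) (by intro x; simp)]
    rw [Finset.sum_const_nat]
    intro b hb
    rw [← MonoidHom.card_fiber_eq_of_mem_range φ (x := b) (y := 1) (hs b) (hs 1)]
    congr 1
    ext a
    simp only [Finset.mem_filter, Finset.mem_univ, true_and] at hb ⊢
    constructor
    · exact fun h => h.2
    · rintro rfl; exact ⟨hb, rfl⟩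
  have h2 : (Finset.univ.filter (fun x : G => φ x ^ 2 = φ u)).card =
      (Finset.univ.filter (fun x : G => φ x = 1)).card *
        (Finset.univ.filter (fun x : G => x ^ 2 = u)).card := by
    rw [← MonoidHom.card_fiber_eq_of_mem_range φ (x := φ u) (y := 1) (hs _) (hs 1)]
    rw [Finset.card_eq_sum_card_fiberwise (f := fun x : G => x ^ 2)
      (t := Finset.univ.filter (fun x : G => φ x = φ u)) (by intro x; simp)]
    rw [Finset.sum_const_nat]
    intro b hb
    simp only [Finset.mem_filter, Finset.mem_univ, true_and] at hb
    obtain ⟨s, hs'⟩ := hk (b / u) (by simp [hb])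
    have hb' : b = u * s ^ 2 := by rw [hs']; simp
    apply Finset.card_bij (fun a _ => a / s)
    · intro a ha
      simp only [Finset.mem_filter, Finset.mem_univ, true_and] at ha ⊢
      rw [div_pow, ha.2, hb']; simp
    · intro a _ a' _ h
      simpa using h
    · intro a ha
      simp only [Finset.mem_filter, Finset.mem_univ, true_and] at ha ⊢
      refine ⟨a * s, ⟨?_, ?_⟩, by simp⟩
      · rw [← map_pow, mul_pow, ha, ← hb', hb]
      · rw [mul_pow, ha, ← hb']
  have h3 : 0 < (Finset.univ.filter (fun x : G => φ x = 1)).card :=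
    Finset.card_pos.mpr ⟨1, by simp⟩
  have h4 := h1.symm.trans h2
  rw [mul_comm] at h4
  exact (Nat.eq_of_mul_eq_mul_left h3 h4).symm

open Classical in
/-- Number of unit square roots of `u`. -/
noncomputable def unitRoots (R : Type*) [CommRing R] [Fintype R] (u : R) : ℕ :=
  (Finset.univ.filter (fun x : R => IsUnit x ∧ x ^ 2 = u)).card

open Classical in
theorem unitRoots_units {R : Type*} [CommRing R] [Fintype R] (u : Rˣ) :
    unitRoots R (u : R) = (Finset.univ.filter (fun x : Rˣ => x ^ 2 = u)).card := by
  symm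
  unfold unitRoots
  refine Finset.card_bij (fun (a : Rˣ) _ => (a : R)) ?_ ?_ ?_
  · intro a ha
    simp only [Finset.mem_filter, Finset.mem_univ, true_and] at ha ⊢
    exact ⟨a.isUnit, by rw [← ha]; simp⟩
  · intro a _ b _ h
    exact Units.ext h
  · intro b hb
    simp only [Finset.mem_filter, Finset.mem_univ, true_and] at hb
    obtain ⟨⟨b, rfl⟩, h⟩ := hb
    refine ⟨b, ?_, rfl⟩
    simp only [Finset.mem_filter, Finset.mem_univ, true_and]
    exact Units.ext (by simpa using h)

theorem unitRoots_nonunit {R : Type*} [CommRing R] [Fintype R] (u : R) (hu : ¬ IsUnit u) :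
    unitRoots R u = 0 := by
  classical
  unfold unitRoots
  rw [Finset.card_eq_zero, Finset.filter_eq_empty_iff]
  rintro x - ⟨hx, rfl⟩
  exact hu (hx.pow 2)

theorem unitRoots_lift {R S : Type*} [CommRing R] [Fintype R] [CommRing S] [Fintype S]
    (φ : R →+* S) [IsLocalHom φ] (hs : Function.Surjective (Units.map (φ : R →* S)))
    (hk : ∀ g : R, φ g = 1 → ∃ s, s ^ 2 = g) (u : R) :
    unitRoots R u = unitRoots S (φ u) := by
  classical
  by_cases hu : IsUnit u
  · obtain ⟨u, rfl⟩ := hu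
    rw [unitRoots_units]
    have := group_lift (Units.map (φ : R →* S)) hs (by
      intro g hg
      obtain ⟨s, h⟩ := hk g (by simpa using congrArg Units.val hg)
      have hsu : IsUnit s := by
        have : IsUnit (s ^ 2) := by rw [h]; exact g.isUnit
        exact (isUnit_pow_iff two_ne_zero).1 this
      obtain ⟨s, rfl⟩ := hsu
      exact ⟨s, Units.ext (by simpa using h)⟩) u
    have h2 := unitRoots_units (Units.map (φ : R →* S) u)
    have h3 : unitRoots S (φ u) = unitRoots S ((Units.map (φ : R →* S) u : Sˣ) : S) := rfl
    rw [h3, h2]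
    convert this
  · rw [unitRoots_nonunit u hu, unitRoots_nonunit]
    exact fun h => hu (isUnit_of_map_unit φ u h)

theorem sum_lift {R S : Type*} [CommRing R] [Fintype R] [CommRing S] [Fintype S]
    (φ : R →+* S) (hs : Function.Surjective φ) (f : S → ℕ) :
    (∑ a, f (φ a)) * Fintype.card S = (∑ b, f b) * Fintype.card R := by
  classical
  have key : ∀ f : S → ℕ, ∑ a, f (φ a) =
      (∑ b, f b) * (Finset.univ.filter (fun x : R => φ x = 0)).card := by
    intro f
    rw [← Finset.sum_fiberwise (s := Finset.univ) (g := φ), Finset.sum_mul]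
    refine Finset.sum_congr rfl fun b _ => ?_
    rw [← AddMonoidHom.card_fiber_eq_of_mem_range φ (x := b) (y := 0) (hs _) (hs _),
      mul_comm, ← smul_eq_mul, ← Finset.sum_const]
    refine Finset.sum_congr rfl fun a ha => ?_
    rw [(Finset.mem_filter.1 ha).2]
  have h1 := key (fun _ => 1)
  simp only [Finset.sum_const, Finset.card_univ, smul_eq_mul, mul_one] at h1
  rw [key, h1]; ring

open Classical in
/-- Number of solutions with one of the first two coordinates a unit. -/
noncomputable def goodCount (R : Type*) [CommRing R] [Fintype R] (c n : R) : ℕ :=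
  (Finset.univ.filter (fun v : R × R × R => (IsUnit v.1 ∨ IsUnit v.2.1) ∧
    v.1 ^ 2 + v.2.1 ^ 2 + c * v.2.2 ^ 2 = n)).card

open Classical in
theorem goodCount_eq {R : Type*} [CommRing R] [Fintype R] (c n : R) :
    goodCount R c n = ∑ y : R, ∑ z : R,
      (if IsUnit y then 1 else 2) * unitRoots R (n - y ^ 2 - c * z ^ 2) := by
  have h : ∀ a b : R, (if (IsUnit a ∨ IsUnit b) then 1 else 0 : ℕ) =
      (if IsUnit a then 1 else 0) + (if IsUnit b then (if IsUnit a then 0 else 1) else 0) := by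
    intro a b
    by_cases ha : IsUnit a <;> by_cases hb : IsUnit b <;> simp [ha, hb]
  have e1 : goodCount R c n = ∑ x : R, ∑ y : R, ∑ z : R,
      (if (IsUnit x ∨ IsUnit y) then 1 else 0) *
        (if x ^ 2 + y ^ 2 + c * z ^ 2 = n then 1 else 0) := by
    unfold goodCount
    rw [Finset.card_filter, Fintype.sum_prod_type]
    refine Finset.sum_congr rfl fun x _ => ?_
    rw [Fintype.sum_prod_type]
    refine Finset.sum_congr rfl fun y _ => Finset.sum_congr rfl fun z _ => ?_
    by_cases h1 : (IsUnit x ∨ IsUnit y) <;> simp [h1]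
  have e2 : ∀ u, unitRoots R u = ∑ x : R, (if IsUnit x then 1 else 0) * (if x ^ 2 = u then 1 else 0) := by
    intro u
    unfold unitRoots
    rw [Finset.card_filter]
    refine Finset.sum_congr rfl fun x _ => ?_
    by_cases h1 : IsUnit x <;> simp [h1]
  have e3 : ∀ y z x : R, (x ^ 2 = n - y ^ 2 - c * z ^ 2) ↔ x ^ 2 + y ^ 2 + c * z ^ 2 = n := by
    intro y z x
    rw [eq_sub_iff_add_eq, eq_sub_iff_add_eq, add_right_comm]
  have e4 : ∀ y z x : R, (y ^ 2 + x ^ 2 + c * z ^ 2 = n) ↔ x ^ 2 + y ^ 2 + c * z ^ 2 = n := by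
    intro y z x; rw [add_comm (x ^ 2)]
  rw [e1]
  simp only [h, add_mul, Finset.sum_add_distrib]
  have f1 : ∑ x : R, ∑ y : R, ∑ z : R, (if IsUnit x then 1 else 0) *
        (if x ^ 2 + y ^ 2 + c * z ^ 2 = n then 1 else 0) =
      ∑ y : R, ∑ z : R, unitRoots R (n - y ^ 2 - c * z ^ 2) := by
    rw [Finset.sum_comm]
    refine Finset.sum_congr rfl fun y _ => ?_
    rw [Finset.sum_comm]
    refine Finset.sum_congr rfl fun z _ => ?_
    rw [e2]
    simp only [e3]
  have f2 : ∑ x : R, ∑ y : R, ∑ z : R, (if IsUnit y then (if IsUnit x then 0 else 1) else 0) *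
        (if x ^ 2 + y ^ 2 + c * z ^ 2 = n then 1 else 0) =
      ∑ y : R, ∑ z : R, (if IsUnit y then 0 else 1) * unitRoots R (n - y ^ 2 - c * z ^ 2) := by
    refine Finset.sum_congr rfl fun x _ => ?_
    rw [Finset.sum_comm]
    refine Finset.sum_congr rfl fun z _ => ?_
    rw [e2, Finset.mul_sum]
    refine Finset.sum_congr rfl fun y _ => ?_
    simp only [e3, e4 x z y]
    by_cases h1 : IsUnit x <;> by_cases h2 : IsUnit y <;> simp [h1, h2]
  rw [f1, f2, ← Finset.sum_add_distrib]
  refine Finset.sum_congr rfl fun y _ => ?_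
  rw [← Finset.sum_add_distrib]
  refine Finset.sum_congr rfl fun z _ => ?_
  by_cases h1 : IsUnit y <;> simp [h1]; ring

theorem goodCount_lift {R S : Type*} [CommRing R] [Fintype R] [CommRing S] [Fintype S]
    (φ : R →+* S) [IsLocalHom φ] (hs0 : Function.Surjective φ)
    (hs : Function.Surjective (Units.map (φ : R →* S)))
    (hk : ∀ g : R, φ g = 1 → ∃ s, s ^ 2 = g) (c n : R) :
    goodCount R c n * Fintype.card S ^ 2 = goodCount S (φ c) (φ n) * Fintype.card R ^ 2 := by
  classical
  let f : S → S → ℕ := fun y z =>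
    (if IsUnit y then 1 else 2) * unitRoots S (φ n - y ^ 2 - φ c * z ^ 2)
  have h1 : goodCount R c n = ∑ y, ∑ z, f (φ y) (φ z) := by
    rw [goodCount_eq]
    refine Finset.sum_congr rfl fun y _ => Finset.sum_congr rfl fun z _ => ?_
    rw [unitRoots_lift φ hs hk]
    simp only [f, map_sub, map_mul, map_pow, isUnit_map_iff]
  have h2 : goodCount S (φ c) (φ n) = ∑ y, ∑ z, f y z := by
    rw [goodCount_eq]
  have h3 := sum_lift φ hs0 (fun y => ∑ z, f y (φ z))
  have h4 : (∑ y, ∑ z, f y (φ z)) * Fintype.card S = (∑ y, ∑ z, f y z) * Fintype.card R := by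
    rw [Finset.sum_mul, Finset.sum_mul]
    exact Finset.sum_congr rfl fun y _ => sum_lift φ hs0 (f y)
  rw [h1, h2, pow_two, ← mul_assoc, h3, mul_right_comm, h4]
  ring

/-- Hensel for squares. -/
theorem sq_of_one {p : ℕ} [Fact p.Prime] (μ ν : ℕ) (h : p ^ μ ∣ p ^ ν)
    (hμ : (p : ℝ) ^ (-(μ : ℤ)) < ‖(2 : ℤ_[p])‖ ^ 2) (g : ZMod (p ^ ν))
    (hg : ZMod.castHom h (ZMod (p ^ μ)) g = 1) : ∃ s, s ^ 2 = g := by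
  obtain ⟨k, rfl⟩ := ZMod.intCast_surjective g
  rw [map_intCast] at hg
  have hd : ((p ^ μ : ℕ) : ℤ) ∣ 1 - k := by
    rw [← ZMod.intCast_zmod_eq_zero_iff_dvd] 
    push_cast at hg ⊢
    rw [hg, sub_self]
  have hn : ‖((1 - k : ℤ) : ℤ_[p])‖ ≤ (p : ℝ) ^ (-(μ : ℤ)) := by
    rw [PadicInt.norm_int_le_pow_iff_dvd]; exact_mod_cast hd
  obtain ⟨z, hz, -⟩ := hensels_lemma (p := p) (R := ℤ_[p])
    (F := Polynomial.X ^ 2 - Polynomial.C (k : ℤ_[p])) (a := 1) (by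
      simp only [map_sub, map_pow, Polynomial.aeval_X, Polynomial.aeval_C, Polynomial.derivative_X_pow,
        Polynomial.derivative_C]
      simp only [Algebra.algebraMap_self, RingHom.id_apply, map_mul, Polynomial.aeval_X, one_pow, map_zero, sub_zero, mul_one, map_pow, map_natCast]
      refine lt_of_le_of_lt ?_ hμ
      push_cast at hn
      exact hn)
  refine ⟨PadicInt.toZModPow ν z, ?_⟩
  have : z ^ 2 = (k : ℤ_[p]) := by
    simpa [sub_eq_zero] using hz
  rw [← map_pow, this, map_intCast]

theorem count_field {p : ℕ} [Fact p.Prime] (hp : p ≠ 2) (n : ZMod p) (hn : n ≠ 0) :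
    p * (p - 1) ≤ goodCount (ZMod p) 0 n := by
  classical
  set χ := quadraticChar (ZMod p) with hχ
  have hc : ringChar (ZMod p) ≠ 2 := by rwa [ZMod.ringChar_zmod_n]
  have hJ : ∑ x, χ x * χ (1 - x) = -χ (-1) := by
    have := jacobiSum_nontrivial_inv (χ := χ) (quadraticChar_ne_one hc)
    rwa [(quadraticChar_isQuadratic (ZMod p)).inv] at this
  have hJ2 : ∑ x, χ x * χ (n - x) = -χ (-1) := by
    rw [← hJ, ← Equiv.sum_comp (Equiv.mulLeft₀ n hn)]
    refine Finset.sum_congr rfl fun x _ => ?_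
    have h1 : n - n * x = n * (1 - x) := by ring
    have h2 : χ n ^ 2 = 1 := quadraticChar_sq_one hn
    change χ (n * x) * χ (n - n * x) = _
    simp only [h1, map_mul]
    linear_combination (χ x * χ (1 - x)) * h2
  have hr : ∀ a : ZMod p, (((Finset.univ.filter (fun x : ZMod p => x ^ 2 = a)).card : ℕ) : ℤ) = χ a + 1 := by
    intro a
    rw [← quadraticChar_card_sqrts hc a]
    congr 2
    ext x; simp
  have hsum : ∑ a, χ a = 0 := quadraticChar_sum_zero hc
  have hsum2 : ∑ a, χ (n - a) = 0 := by
    rw [← hsum]; exact (Equiv.subLeft n).sum_comp χ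
  have hcount : (((Finset.univ.filter (fun v : ZMod p × ZMod p => v.1 ^ 2 + v.2 ^ 2 = n)).card : ℕ) : ℤ)
      = p - χ (-1) := by
    have : (Finset.univ.filter (fun v : ZMod p × ZMod p => v.1 ^ 2 + v.2 ^ 2 = n)).card =
      ∑ a : ZMod p, (Finset.univ.filter (fun x : ZMod p => x ^ 2 = a)).card *
        (Finset.univ.filter (fun x : ZMod p => x ^ 2 = n - a)).card := by
      rw [Finset.card_eq_sum_card_fiberwise (f := fun v : ZMod p × ZMod p => v.1 ^ 2)
        (t := Finset.univ) (by intro x; simp)]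
      refine Finset.sum_congr rfl fun a _ => ?_
      rw [← Finset.card_product]
      congr 1
      ext ⟨x, y⟩
      simp only [Finset.mem_filter, Finset.mem_univ, true_and, Finset.mem_product]
      constructor
      · rintro ⟨h1, h2⟩; exact ⟨h2, by rw [← h1, ← h2]; ring⟩
      · rintro ⟨h1, h2⟩; exact ⟨by rw [h1, h2]; ring, h1⟩
    rw [this]
    push_cast
    simp only [hr]
    have : ∀ a, (χ a + 1) * (χ (n - a) + 1) = χ a * χ (n - a) + χ a + χ (n - a) + 1 := by
      intro a; ring
    simp only [this, Finset.sum_add_distrib, hJ2, hsum, hsum2]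
    simp [ZMod.card]
    ring
  have hle : p - 1 ≤ (Finset.univ.filter (fun v : ZMod p × ZMod p => v.1 ^ 2 + v.2 ^ 2 = n)).card := by
    have : χ (-1) ≤ 1 := by
      rcases quadraticChar_isQuadratic (ZMod p) (-1) with h | h | h <;> rw [hχ, h] <;> norm_num
    omega
  have hg : goodCount (ZMod p) 0 n = p *
      (Finset.univ.filter (fun v : ZMod p × ZMod p => v.1 ^ 2 + v.2 ^ 2 = n)).card := by
    have hcard : (Finset.univ : Finset (ZMod p)).card = p := by
      rw [Finset.card_univ, ZMod.card]
    have hpr := Finset.card_product (Finset.univ : Finset (ZMod p))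
      (Finset.univ.filter (fun v : ZMod p × ZMod p => v.1 ^ 2 + v.2 ^ 2 = n))
    rw [hcard] at hpr
    rw [← hpr]
    unfold goodCount
    apply Finset.card_bij (fun v _ => (v.2.2, (v.1, v.2.1)))
    · rintro ⟨x, y, z⟩ h
      simp only [Finset.mem_filter, Finset.mem_univ, true_and, Finset.mem_product] at h ⊢
      simpa using h.2
    · rintro ⟨x, y, z⟩ _ ⟨x', y', z'⟩ _ h
      simp only [Prod.mk.injEq] at h ⊢
      tauto
    · rintro ⟨z, x, y⟩ h
      refine ⟨(x, y, z), ?_, rfl⟩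
      have h' : x ^ 2 + y ^ 2 = n := by simpa using h
      simp only [Finset.mem_filter, Finset.mem_univ, true_and]
      refine ⟨?_, by rw [h']; ring⟩
      by_contra hcon
      simp only [isUnit_iff_ne_zero] at hcon
      push Not at hcon
      rw [hcon.1, hcon.2] at h'
      exact hn (by rw [← h']; ring)
  rw [hg]
  exact Nat.mul_le_mul_left _ hle

set_option maxRecDepth 100000 in
set_option maxHeartbeats 4000000 in
theorem count_eight_aux : ∀ c n : ZMod 8, (c = 2 ∨ c = 6) → (n = 1 ∨ n = 3 ∨ n = 5 ∨ n = 7) →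
    32 ≤ ∑ x : ZMod 8, ∑ y : ZMod 8, ∑ z : ZMod 8,
      (if x ^ 2 + y ^ 2 + c * z ^ 2 = n then 1 else 0) := by
  decide

theorem localCount_eq (P n p ν : ℕ) [Fact p.Prime] (hp : p ∣ 6 * P) (hn : n.Coprime p) (hν : ν ≠ 0) :
    localCount P n p ν = goodCount (ZMod (p ^ ν)) ((6 * P : ℕ) : ZMod (p ^ ν)) (n : ZMod (p ^ ν)) := by
  classical
  unfold localCount goodCount
  rw [Nat.card_eq_fintype_card, Fintype.card_subtype]
  congr 1
  ext ⟨x, y, z⟩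
  simp only [Finset.mem_filter, Finset.mem_univ, true_and]
  constructor
  · intro h
    refine ⟨?_, h⟩
    by_contra hcon
    push Not at hcon
    have hd : p ∣ p ^ ν := dvd_pow_self p hν
    have hu : ∀ x : ZMod (p ^ ν), ¬ IsUnit x → ZMod.castHom hd (ZMod p) x = 0 := by
      intro x hx
      obtain ⟨k, rfl⟩ := ZMod.natCast_zmod_surjective x
      rw [ZMod.isUnit_iff_coprime] at hx
      rw [map_natCast, ZMod.natCast_eq_zero_iff]
      by_contra hk
      exact hx (Nat.Coprime.pow_right _ ((Nat.Prime.coprime_iff_not_dvd Fact.out).2 hk).symm)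
    have h' := congrArg (ZMod.castHom hd (ZMod p)) h
    simp only [map_add, map_pow, map_mul, map_natCast, hu x hcon.1, hu y hcon.2] at h'
    rw [(ZMod.natCast_eq_zero_iff (6 * P) p).2 hp] at h'
    have h0 : (n : ZMod p) = 0 := by rw [← h']; ring
    rw [ZMod.natCast_eq_zero_iff] at h0
    exact (Nat.Prime.coprime_iff_not_dvd Fact.out).1 hn.symm h0
  · exact fun h => h.2

theorem density_general (P n p μ : ℕ) [hpf : Fact p.Prime] (hp : p ∣ 6 * P) (hn : n.Coprime p)
    (hμ0 : μ ≠ 0) (hμ : (p : ℝ) ^ (-(μ : ℤ)) < ‖(2 : ℤ_[p])‖ ^ 2) :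
    Tendsto (fun ν : ℕ => (localCount P n p ν : ℝ) / (p : ℝ) ^ (2 * ν)) atTop
      (nhds ((localCount P n p μ : ℝ) / (p : ℝ) ^ (2 * μ))) := by
  apply tendsto_const_nhds.congr'
  filter_upwards [eventually_ge_atTop μ] with ν hν
  have hν0 : ν ≠ 0 := by omega
  have hd : p ^ μ ∣ p ^ ν := pow_dvd_pow p hν
  have hp0 : (p : ℝ) ≠ 0 := by exact_mod_cast hpf.out.ne_zero
  have : IsLocalHom (ZMod.castHom hd (ZMod (p ^ μ))) := by
    constructor
    intro a ha
    obtain ⟨k, rfl⟩ := ZMod.natCast_zmod_surjective a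
    rw [map_natCast, ZMod.isUnit_iff_coprime] at ha
    rw [ZMod.isUnit_iff_coprime]
    exact Nat.Coprime.pow_right _ ((Nat.coprime_pow_right_iff (Nat.pos_of_ne_zero hμ0) _ _).1 ha)
  have h := goodCount_lift (ZMod.castHom hd (ZMod (p ^ μ))) (ZMod.castHom_surjective hd)
    (ZMod.unitsMap_surjective hd) (sq_of_one μ ν hd hμ)
    ((6 * P : ℕ) : ZMod (p ^ ν)) (n : ZMod (p ^ ν))
  rw [map_natCast, map_natCast, ← localCount_eq P n p ν hp hn hν0,
    ← localCount_eq P n p μ hp hn hμ0, ZMod.card, ZMod.card] at h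
  rw [div_eq_div_iff (by positivity) (by positivity), pow_mul', pow_mul']
  exact_mod_cast h.symm

theorem density_odd (P n p : ℕ) [hpf : Fact p.Prime] (hp2 : p ≠ 2) (hp : p ∣ 6 * P)
    (hn : n.Coprime p) :
    ∃ L : ℝ, Tendsto (fun ν : ℕ => (localCount P n p ν : ℝ) / (p : ℝ) ^ (2 * ν)) atTop (nhds L) ∧
      1 - 1 / (p : ℝ) ≤ L := by
  have h1p : 1 < p := hpf.out.one_lt
  refine ⟨_, density_general P n p 1 hp hn one_ne_zero ?_, ?_⟩
  · have h2 : ‖(2 : ℤ_[p])‖ = 1 := by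
      have h := PadicInt.norm_int_lt_one_iff_dvd (p := p) 2
      have h3 : ¬ ((p : ℤ) ∣ 2) := by
        intro h4
        have h5 : p ∣ 2 := by exact_mod_cast h4
        exact hp2 ((Nat.prime_dvd_prime_iff_eq hpf.out Nat.prime_two).1 h5)
      have h6 := PadicInt.norm_le_one (2 : ℤ_[p])
      push_cast at h
      exact le_antisymm h6 (not_lt.1 (fun h7 => h3 (h.1 h7)))
    rw [h2]
    simp only [Nat.cast_one, zpow_neg, zpow_one, one_pow]
    exact inv_lt_one_of_one_lt₀ (by exact_mod_cast h1p)
  · have hle : p * (p - 1) ≤ localCount P n p 1 := by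
      rw [localCount_eq P n p 1 hp hn one_ne_zero]
      have key : ∀ m, m = p → p * (p - 1) ≤ goodCount (ZMod p) ((6 * P : ℕ) : ZMod p) (n : ZMod p) := by
        intro _ _
        rw [(ZMod.natCast_eq_zero_iff (6 * P) p).2 hp]
        apply count_field hp2
        rw [Ne, ZMod.natCast_eq_zero_iff]
        exact (Nat.Prime.coprime_iff_not_dvd Fact.out).1 hn.symm
      have key2 : ∀ m (inst : Fintype (ZMod m)), m = p → p * (p - 1) ≤
          @goodCount (ZMod m) _ inst ((6 * P : ℕ) : ZMod m) (n : ZMod m) := by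
        rintro m inst rfl
        convert key m rfl
      exact key2 _ _ (pow_one p)
    have hpos : (0 : ℝ) < p := by positivity
    rw [le_div_iff₀ (by positivity)]
    have h3 : ((p * (p - 1) : ℕ) : ℝ) ≤ localCount P n p 1 := by exact_mod_cast hle
    rw [Nat.cast_mul, Nat.cast_sub h1p.le] at h3
    refine le_trans (le_of_eq ?_) h3
    field_simp
    push_cast
    ring

theorem density_two (P n : ℕ) (hP : Odd P) (hn : Odd n) :
    ∃ L : ℝ, Tendsto (fun ν : ℕ => (localCount P n 2 ν : ℝ) / (2 : ℝ) ^ (2 * ν)) atTop (nhds L) ∧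
      1 / 2 ≤ L := by
  have h := density_general P n 2 3 ⟨3 * P, by ring⟩ (Nat.coprime_two_right.2 hn) (by norm_num) (by
    have := PadicInt.norm_p (p := 2)
    push_cast at this
    rw [this]
    norm_num)
  refine ⟨_, by exact_mod_cast h, ?_⟩
  have hle : 32 ≤ localCount P n 2 3 := by
    unfold localCount
    rw [Nat.card_eq_fintype_card, Fintype.card_subtype, Finset.card_filter, Fintype.sum_prod_type]
    simp only [Fintype.sum_prod_type]
    refine count_eight_aux ((6 * P : ℕ) : ZMod 8) (n : ZMod 8) ?_ ?_
    · obtain ⟨k, rfl⟩ := hP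
      push_cast
      generalize (k : ZMod 8) = t
      revert t
      decide
    · obtain ⟨k, rfl⟩ := hn
      push_cast
      generalize (k : ZMod 8) = t
      revert t
      decide
  have : (32 : ℝ) ≤ localCount P n 2 3 := by exact_mod_cast hle
  rw [le_div_iff₀ (by positivity)]
  norm_num
  linarith

theorem local_densities (P : ℕ) (hP : P.Prime) (hP6 : ¬ P ∣ 6) (n : ℕ) (hn : 0 < n)
    (hcop : Nat.Coprime n (6 * P)) :
    (∃ L₂ : ℝ, Tendsto (fun ν : ℕ => (localCount P n 2 ν : ℝ) / (2 : ℝ) ^ (2 * ν))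
        atTop (nhds L₂) ∧ (1 : ℝ) / 2 ≤ L₂) ∧
    (∃ L₃ : ℝ, Tendsto (fun ν : ℕ => (localCount P n 3 ν : ℝ) / (3 : ℝ) ^ (2 * ν))
        atTop (nhds L₃) ∧ (2 : ℝ) / 3 ≤ L₃) ∧
    (∃ LP : ℝ, Tendsto (fun ν : ℕ => (localCount P n P ν : ℝ) / (P : ℝ) ^ (2 * ν))
        atTop (nhds LP) ∧ 1 - 1 / (P : ℝ) ≤ LP) := by
  have hP2 : P ≠ 2 := by rintro rfl; exact hP6 (by norm_num)
  have : Fact P.Prime := ⟨hP⟩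
  have h6 : Nat.Coprime n 6 := hcop.coprime_mul_right_right
  refine ⟨density_two P n (hP.odd_of_ne_two hP2) ?_, ?_, ?_⟩
  · exact Nat.coprime_two_right.1 (h6.coprime_dvd_right (by norm_num))
  · obtain ⟨L, h1, h2⟩ := density_odd P n 3 (by norm_num) ⟨2 * P, by ring⟩
      (h6.coprime_dvd_right (by norm_num))
    refine ⟨L, by exact_mod_cast h1, ?_⟩
    norm_num at h2 ⊢
    exact h2
  · exact density_odd P n P hP2 ⟨6, by ring⟩ hcop.coprime_mul_left_right
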